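/- Suppose k is an algebraically closed field of characteristic 0 and P is a finite group of equivariant permutations, acting on K := {m ∈ Φ →₀ ℤ : t_A(m) = 0} by relabeling. Let F, F' : Φ → k be nowhere zero. Then there exist ρ ∈ P and a gauge transformation g with F' = g·(ρ·F) if and only if for every finitely supported P-invariant function c : K → ℤ (meaning c(ρ·m) = c(m) for all ρ ∈ P and m ∈ K), one has ∑_{m ∈ K} c(m)·F(m) = ∑_{m ∈ K} c(m)·F'(m) in k; that is, P-invariant integer linear combinations of invariant-monomial evaluations classify combined permutation-and-gauge (monoidal) equivalence classes of nowhere-zero points. -/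

import Mathlib

open Finsupp

/-- The unique additive homomorphism `(Φ →₀ ℤ) →+ (Γ →₀ ℤ)` sending `single φ 1` to `t φ`. -/
noncomputable def tA {Φ Γ : Type*} (t : Φ → (Γ →₀ ℤ)) : (Φ →₀ ℤ) →+ (Γ →₀ ℤ) :=
  Finsupp.liftAddHom fun φ => zmultiplesHom _ (t φ)

theorem tA_single {Φ Γ : Type*} (t : Φ → (Γ →₀ ℤ)) (φ : Φ) :
    tA t (Finsupp.single φ 1) = t φ := by
  simp [tA]

/-- The action of a gauge transformation `g : Γ → kˣ` on `F : Φ → k`. -/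
noncomputable def gaugeAct {k : Type*} [Field k] {Φ Γ : Type*} [Fintype Γ]
    (t : Φ → (Γ →₀ ℤ)) (g : Γ → kˣ) (F : Φ → k) : Φ → k :=
  fun φ => ((∏ γ : Γ, g γ ^ (t φ) γ : kˣ) : k) * F φ

/-- Gauge equivalence of `F, F' : Φ → k`. -/
def gaugeEquiv {k : Type*} [Field k] {Φ Γ : Type*} [Fintype Γ]
    (t : Φ → (Γ →₀ ℤ)) (F F' : Φ → k) : Prop :=
  ∃ g : Γ → kˣ, F' = gaugeAct t g F

/-- Evaluation of a monomial `m : Φ →₀ ℤ` at a point `F : Φ → k`. -/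
noncomputable def evalMon {k : Type*} [Field k] {Φ : Type*} [Fintype Φ] (F : Φ → k) (m : Φ →₀ ℤ) : k :=
  ∏ φ : Φ, F φ ^ m φ

/-- The action of a permutation of `Φ` on `F : Φ → k`. -/
def permAct {k Φ : Type*} (ρ : Equiv.Perm Φ) (F : Φ → k) : Φ → k :=
  fun φ => F (ρ.symm φ)

theorem tA_apply {Φ Γ : Type*} [Fintype Φ] (t : Φ → (Γ →₀ ℤ)) (m : Φ →₀ ℤ) (γ : Γ) :
    tA t m γ = ∑ φ, m φ * t φ γ := by
  rw [tA, Finsupp.liftAddHom_apply, Finsupp.sum_fintype _ _ (by simp), Finsupp.finsetSum_apply]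
  simp

theorem tA_equivMapDomain {Φ Γ : Type*} [Fintype Φ] {t : Φ → (Γ →₀ ℤ)}
    {σ : Equiv.Perm Φ} {τ : Equiv.Perm Γ}
    (h : ∀ φ, t (σ φ) = Finsupp.equivMapDomain τ (t φ)) (m : Φ →₀ ℤ) :
    tA t (Finsupp.equivMapDomain σ m) = Finsupp.equivMapDomain τ (tA t m) := by
  ext γ
  rw [Finsupp.equivMapDomain_apply, tA_apply, tA_apply, ← Equiv.sum_comp σ]
  simp [h]

theorem tA_equivMapDomain_eq_zero_iff {Φ Γ : Type*} [Fintype Φ] {t : Φ → (Γ →₀ ℤ)}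
    {σ : Equiv.Perm Φ} {τ : Equiv.Perm Γ}
    (h : ∀ φ, t (σ φ) = Finsupp.equivMapDomain τ (t φ)) (m : Φ →₀ ℤ) :
    tA t (Finsupp.equivMapDomain σ m) = 0 ↔ tA t m = 0 := by
  rw [tA_equivMapDomain h, ← Finsupp.equivCongrLeft_apply]
  constructor
  · intro h0
    ext γ
    simpa using DFunLike.congr_fun h0 (τ γ)
  · intro h0
    ext γ
    simp [h0]

theorem evalMon_permAct {k Φ : Type*} [Field k] [Fintype Φ] (σ : Equiv.Perm Φ) (F : Φ → k)
    (m : Φ →₀ ℤ) :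
    evalMon (permAct σ F) m = evalMon F (Finsupp.equivMapDomain σ.symm m) := by
  unfold evalMon permAct
  rw [← Equiv.prod_comp σ]
  simp

theorem evalMon_gaugeAct {k Φ Γ : Type*} [Field k] [Fintype Φ] [Fintype Γ] (t : Φ → (Γ →₀ ℤ))
    (g : Γ → kˣ) (F : Φ → k) (m : Φ →₀ ℤ) :
    evalMon (gaugeAct t g F) m = ((∏ γ, g γ ^ tA t m γ : kˣ) : k) * evalMon F m := by
  have h : ∏ φ, (∏ γ, g γ ^ t φ γ) ^ m φ = ∏ γ, g γ ^ tA t m γ := by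
    simp_rw [tA_apply, ← Finset.prod_zpow, ← zpow_mul]
    rw [Finset.prod_comm]
    refine Finset.prod_congr rfl fun γ _ => ?_
    simp_rw [mul_comm (t _ γ)]
    exact congrArg Additive.toMul
      (Finset.sum_smul (f := fun φ => m φ * t φ γ) (x := Additive.ofMul (g γ))
        (s := Finset.univ)).symm
  unfold evalMon gaugeAct
  simp_rw [mul_zpow]
  rw [Finset.prod_mul_distrib, ← h]
  push_cast
  rfl

theorem evalMon_gaugeAct_of_tA_eq_zero {k Φ Γ : Type*} [Field k] [Fintype Φ] [Fintype Γ]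
    (t : Φ → (Γ →₀ ℤ)) (g : Γ → kˣ) (F : Φ → k) {m : Φ →₀ ℤ} (hm : tA t m = 0) :
    evalMon (gaugeAct t g F) m = evalMon F m := by
  simp [evalMon_gaugeAct, hm]

theorem evalMon_add {k Φ : Type*} [Field k] [Fintype Φ] {F : Φ → k} (hF : ∀ φ, F φ ≠ 0)
    (m n : Φ →₀ ℤ) : evalMon F (m + n) = evalMon F m * evalMon F n := by
  simp [evalMon, zpow_add₀ (hF _), Finset.prod_mul_distrib]

/-- A nowhere-zero point `F` as a character of the group of invariant monomials. -/
noncomputable def invariantCharacter {k Φ Γ : Type*} [Field k] [Fintype Φ] (t : Φ → (Γ →₀ ℤ))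
    (F : Φ → k) (hF : ∀ φ, F φ ≠ 0) : Multiplicative (tA t).ker →* k where
  toFun m := evalMon F m.toAdd
  map_one' := by simp [evalMon]
  map_mul' m n := by simp [evalMon_add hF]

/-- The group of units of an algebraically closed field is divisible. -/
noncomputable abbrev unitsDivisibleBy (k : Type*) [Field k] [IsAlgClosed k] :
    DivisibleBy (Additive kˣ) ℤ :=
  letI : DivisibleBy (Additive kˣ) ℕ := divisibleByOfSMulRightSurj _ _ fun {n} hn x => by
    obtain ⟨z, hz⟩ := IsAlgClosed.exists_pow_nat_eq (x.toMul : k) (Nat.pos_of_ne_zero hn)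
    have hz0 : z ≠ 0 := by
      rintro rfl
      exact x.toMul.ne_zero (by rw [← hz, zero_pow hn])
    exact ⟨Additive.ofMul (Units.mk0 z hz0), Additive.toMul.injective (Units.ext hz)⟩
  AddGroup.divisibleByIntOfDivisibleByNat _

/-- Over an algebraically closed field, two nowhere-zero points with the same values on all
invariant monomials are gauge equivalent. -/
theorem gaugeEquiv_of_evalMon_eq {k Φ Γ : Type*} [Field k] [IsAlgClosed k] [Fintype Φ] [Fintype Γ]
    (t : Φ → (Γ →₀ ℤ)) {F F' : Φ → k} (hF : ∀ φ, F φ ≠ 0) (hF' : ∀ φ, F' φ ≠ 0)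
    (h : ∀ m, tA t m = 0 → evalMon F m = evalMon F' m) : gaugeEquiv t F F' := by
  classical
  let q : (Φ →₀ ℤ) →+ Additive kˣ := Finsupp.liftAddHom fun φ =>
    zmultiplesHom _ (Additive.ofMul (Units.mk0 (F' φ) (hF' φ) / Units.mk0 (F φ) (hF φ)))
  have hq (m : Φ →₀ ℤ) : ((q m).toMul : k) = evalMon F' m / evalMon F m := by
    simp only [q, Finsupp.liftAddHom_apply]
    rw [Finsupp.sum_fintype _ _ (by simp)]
    simp [evalMon, div_zpow, Finset.prod_div_distrib]
  have hker : (tA t).ker ≤ q.ker := by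
    intro m hm
    rw [AddMonoidHom.mem_ker] at hm ⊢
    apply Additive.toMul.injective
    apply Units.ext
    rw [hq, h m hm]
    exact div_self (Finset.prod_ne_zero_iff.mpr fun φ _ => zpow_ne_zero _ (hF' φ))
  let := unitsDivisibleBy k
  obtain ⟨e, he⟩ := (Module.Baer.of_divisible (Additive kˣ)).extension_property_addMonoidHom
    (QuotientAddGroup.kerLift (tA t)) (QuotientAddGroup.kerLift_injective _)
    (QuotientAddGroup.lift _ q hker)
  have het (φ : Φ) : e (t φ) = q (Finsupp.single φ 1) := by
    have := DFunLike.congr_fun he ((Finsupp.single φ 1 : Φ →₀ ℤ) : (Φ →₀ ℤ) ⧸ (tA t).ker)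
    simpa [tA_single] using this
  refine ⟨fun γ => (e (Finsupp.single γ 1)).toMul, ?_⟩
  funext φ
  have hexp : e (t φ) = ∑ γ, t φ γ • e (Finsupp.single γ 1) := by
    conv_lhs => rw [← Finsupp.univ_sum_single (t φ)]
    rw [map_sum]
    refine Finset.sum_congr rfl fun γ _ => ?_
    rw [← map_zsmul, Finsupp.smul_single, smul_eq_mul, mul_one]
  have hval : (∏ γ, (e (Finsupp.single γ 1)).toMul ^ t φ γ : kˣ) =
      Units.mk0 (F' φ) (hF' φ) / Units.mk0 (F φ) (hF φ) := by
    have := congrArg Additive.toMul (hexp.symm.trans (het φ))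
    simpa [q] using this
  rw [gaugeAct, hval]
  simp [hF φ]

/-- Equal sums of two finite families of monoid homomorphisms into a domain of characteristic
zero have the same members. -/
theorem exists_eq_of_sum_monoidHom_eq {ι G L : Type*} [Fintype ι] [Monoid G] [CommRing L]
    [IsDomain L] [CharZero L] (χ ψ : ι → G →* L)
    (h : ∀ x, ∑ i, χ i x = ∑ i, ψ i x) (j : ι) : ∃ i, χ i = ψ j := by
  classical
  by_contra! hne
  have hsum : ∑ i, Finsupp.single (χ i) (1 : L) = ∑ i, Finsupp.single (ψ i) (1 : L) := by
    apply linearIndependent_monoidHom G L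
    rw [map_sum, map_sum]
    simp only [Finsupp.linearCombination_single, one_smul]
    funext x
    simpa using h x
  have hj := DFunLike.congr_fun hsum (ψ j)
  simp only [Finsupp.finsetSum_apply, Finsupp.single_apply, hne, if_false,
    Finset.sum_const_zero, Finset.sum_boole] at hj
  have hcard := Nat.cast_eq_zero.mp hj.symm
  rw [Finset.card_eq_zero] at hcard
  simpa using Finset.ext_iff.mp hcard j

/-- For nowhere-zero points, combined permutation-and-gauge (monoidal) equivalence with respect
to a finite group `P` of equivariant permutations is classified by `P`-invariant integer linear
combinations of invariant-monomial evaluations. -/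
theorem monoidalEquiv_iff_invariant_linear_combinations
    {k : Type*} [Field k] [IsAlgClosed k] [CharZero k]
    {Φ Γ : Type*} [Fintype Φ] [Fintype Γ] (t : Φ → (Γ →₀ ℤ))
    (P : Subgroup (Equiv.Perm Φ × Equiv.Perm Γ)) [Finite P]
    (hP : ∀ ρ ∈ P, ∀ φ : Φ, t (ρ.1 φ) = Finsupp.equivMapDomain ρ.2 (t φ))
    (F F' : Φ → k) (hF : ∀ φ, F φ ≠ 0) (hF' : ∀ φ, F' φ ≠ 0) :
    (∃ ρ ∈ P, ∃ g : Γ → kˣ, F' = gaugeAct t g (permAct ρ.1 F)) ↔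
      ∀ c : (Φ →₀ ℤ) →₀ ℤ,
        (∀ m ∈ c.support, tA t m = 0) →
        (∀ ρ ∈ P, ∀ m : Φ →₀ ℤ, tA t m = 0 → c (Finsupp.equivMapDomain ρ.1 m) = c m) →
        (c.sum fun m z => (z : k) * evalMon F m) =
          (c.sum fun m z => (z : k) * evalMon F' m) := by
  classical
  have : Fintype P := Fintype.ofFinite P
  constructor
  · rintro ⟨ρ, hρ, g, rfl⟩ c hc hinv
    have hK := tA_equivMapDomain_eq_zero_iff (hP ρ hρ)
    have hcK {m : Φ →₀ ℤ} (hm : tA t m ≠ 0) : c m = 0 := by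
      by_contra h
      exact hm (hc m (Finsupp.mem_support_iff.mpr h))
    have hce : Finsupp.equivMapDomain (Finsupp.equivCongrLeft ρ.1) c = c := by
      ext m
      obtain ⟨n, rfl⟩ := (Finsupp.equivCongrLeft ρ.1).surjective m
      rw [Finsupp.equivMapDomain_apply, Equiv.symm_apply_apply, Finsupp.equivCongrLeft_apply]
      by_cases hn : tA t n = 0
      · exact (hinv ρ hρ n hn).symm
      · rw [hcK hn, hcK (mt (hK n).mp hn)]
    conv_rhs => rw [← hce]
    rw [Finsupp.sum_equivMapDomain]
    refine Finsupp.sum_congr fun m hm => ?_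
    rw [Finsupp.equivCongrLeft_apply,
      evalMon_gaugeAct_of_tA_eq_zero t g _ ((hK m).mpr (hc m hm)), evalMon_permAct,
      ← Finsupp.equivMapDomain_trans, Equiv.self_trans_symm, Finsupp.equivMapDomain_refl]
  · intro h
    let χ (ρ : P) := invariantCharacter t (permAct ρ.1.1 F) fun φ => hF _
    let ψ (ρ : P) := invariantCharacter t (permAct ρ.1.1 F') fun φ => hF' _
    have hsum (x : Multiplicative (tA t).ker) : ∑ ρ, χ ρ x = ∑ ρ, ψ ρ x := by
      obtain ⟨m, hm⟩ := x
      rw [AddMonoidHom.mem_ker] at hm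
      let c : (Φ →₀ ℤ) →₀ ℤ :=
        ∑ ρ : P, Finsupp.single (Finsupp.equivMapDomain ρ.1.1.symm m) 1
      have hcsum (G : Φ → k) : (c.sum fun m z => (z : k) * evalMon G m) =
          ∑ ρ : P, evalMon (permAct ρ.1.1 G) m := by
        rw [← Finsupp.sum_finsetSum_index (by simp) (by simp [add_mul])]
        simp [evalMon_permAct]
      have hK (ρ : P) : tA t (Finsupp.equivMapDomain ρ.1.1.symm m) = 0 :=
        (tA_equivMapDomain_eq_zero_iff (hP _ (ρ⁻¹).2) m).mpr hm
      have hc := h c ?_ ?_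
      · rwa [hcsum, hcsum] at hc
      · intro n hn
        obtain ⟨ρ, -, hρ⟩ := Finset.mem_biUnion.mp (Finsupp.support_finsetSum hn)
        rw [Finset.mem_singleton.mp (Finsupp.support_single_subset hρ), hK]
      · intro σ hσ n _
        simp only [c, Finsupp.finsetSum_apply]
        refine Fintype.sum_equiv (Equiv.mulRight (⟨σ, hσ⟩ : P)) _ _ fun ρ => ?_
        have hcomp : Finsupp.equivMapDomain ρ.1.1.symm m = Finsupp.equivMapDomain σ.1
            (Finsupp.equivMapDomain (ρ.1.1 * σ.1).symm m) := by
          ext φ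
          simp [Finsupp.equivMapDomain_apply]
        rw [hcomp, Finsupp.single_apply, Finsupp.single_apply]
        exact if_congr (Finsupp.equivCongrLeft σ.1).injective.eq_iff rfl rfl
    obtain ⟨ρ, hρ⟩ := exists_eq_of_sum_monoidHom_eq χ ψ hsum 1
    refine ⟨ρ.1, ρ.2, gaugeEquiv_of_evalMon_eq t (fun φ => hF _) hF' fun m hm => ?_⟩
    exact DFunLike.congr_fun hρ (Multiplicative.ofAdd ⟨m, hm⟩)
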